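/- (Theorem 1) Let Ā be the matrix obtained from A by setting ā_{ij} = 0 whenever (I) a_ij < b_i, or (II) b_i > 0, a_ij ≥ b_i, and there exists i' ≠ i with b_{i'} > 0, a_{i'j} ≥ b_{i'}, and V(b_{i'}, a_{i'j}) < V(b_i, a_ij), or (III) b_i > 0, a_ij ≥ b_i, and there exists i' ≠ i with b_{i'} = 0 and a_{i'j} > 0; and ā_{ij} = a_ij otherwise. Then the max-Dombi systems defined by A and by Ā (with the same right-hand side b) have exactly the same solution sets: {x ∈ [0,1]^n : max_j D_λ(a_ij, x_j) = b_i for all i} = {x ∈ [0,1]^n : max_j D_λ(ā_ij, x_j) = b_i for all i}. -/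

import Mathlib

open scoped Classical

/-- The Dombi t-norm with parameter `l`. -/
noncomputable def dombi (l x y : ℝ) : ℝ :=
  if x = 0 ∨ y = 0 then 0
  else (1 + (((1 - x) / x) ^ l + ((1 - y) / y) ^ l) ^ (1 / l))⁻¹

/-- The solving operation `V(b, a)` associated with the Dombi t-norm. -/
noncomputable def V (l b a : ℝ) : ℝ :=
  (1 + (((1 - b) / b) ^ l - ((1 - a) / a) ^ l) ^ (1 / l))⁻¹

/-- The feasible set `S` of the max-Dombi system `A φ x = b` inside `[0,1]^n`. -/
def feasible (l : ℝ) {m n : ℕ} (A : Fin (m + 1) → Fin (n + 1) → ℝ)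
    (b : Fin (m + 1) → ℝ) : Set (Fin (n + 1) → ℝ) :=
  {x | (∀ j, x j ∈ Set.Icc (0 : ℝ) 1) ∧
    ∀ i, Finset.univ.sup' Finset.univ_nonempty (fun j => dombi l (A i j) (x j)) = b i}

/-- The reduced matrix `Ā` obtained from `A` by the simplification steps
(I), (II) and (III) of Theorem 1. -/
noncomputable def Abar (l : ℝ) {m n : ℕ} (A : Fin (m + 1) → Fin (n + 1) → ℝ)
    (b : Fin (m + 1) → ℝ) (i : Fin (m + 1)) (j : Fin (n + 1)) : ℝ :=
  if A i j < b i then 0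
  else if 0 < b i ∧ ∃ i', i' ≠ i ∧ 0 < b i' ∧ b i' ≤ A i' j ∧
      V l (b i') (A i' j) < V l (b i) (A i j) then 0
  else if 0 < b i ∧ ∃ i', i' ≠ i ∧ b i' = 0 ∧ 0 < A i' j then 0
  else A i j

theorem dombi_zero_left (l y : ℝ) : dombi l 0 y = 0 := by simp [dombi]

theorem dombi_zero_right (l x : ℝ) : dombi l x 0 = 0 := by simp [dombi]

theorem one_sub_div_nonneg {x : ℝ} (hx : x ∈ Set.Ioc (0 : ℝ) 1) : 0 ≤ (1 - x) / x :=
  div_nonneg (sub_nonneg.2 hx.2) hx.1.le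

theorem dombi_pos {l x y : ℝ} (hx : x ∈ Set.Ioc (0 : ℝ) 1) (hy : y ∈ Set.Ioc (0 : ℝ) 1) :
    0 < dombi l x y := by
  have hp := one_sub_div_nonneg hx
  have hq := one_sub_div_nonneg hy
  rw [dombi, if_neg (by rintro (h | h); exacts [hx.1.ne' h, hy.1.ne' h])]
  positivity

theorem dombi_nonneg {l x y : ℝ} (hx : x ∈ Set.Icc (0 : ℝ) 1) (hy : y ∈ Set.Icc (0 : ℝ) 1) :
    0 ≤ dombi l x y := by
  rcases hx.1.eq_or_lt with rfl | hx0
  · rw [dombi_zero_left]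
  rcases hy.1.eq_or_lt with rfl | hy0
  · rw [dombi_zero_right]
  exact (dombi_pos ⟨hx0, hx.2⟩ ⟨hy0, hy.2⟩).le

theorem one_add_inv_lt_iff {q b : ℝ} (hq : 0 ≤ q) (hb : 0 < b) :
    (1 + q)⁻¹ < b ↔ (1 - b) / b < q := by
  rw [inv_lt_comm₀ (by positivity) hb, sub_div, div_self hb.ne', one_div, sub_lt_iff_lt_add']

theorem lt_one_add_inv_iff {q b : ℝ} (hq : 0 ≤ q) (hb : 0 < b) :
    b < (1 + q)⁻¹ ↔ q < (1 - b) / b := by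
  rw [lt_inv_comm₀ hb (by positivity), sub_div, div_self hb.ne', one_div, lt_sub_iff_add_lt']

theorem one_sub_div_le_one_sub_div {a b : ℝ} (hb : 0 < b) (hba : b ≤ a) :
    (1 - a) / a ≤ (1 - b) / b := by
  have ha : 0 < a := hb.trans_le hba
  rw [sub_div, sub_div, div_self hb.ne', div_self ha.ne']
  gcongr

theorem dombi_le_left {l x y : ℝ} (hl : 0 < l) (hx : x ∈ Set.Icc (0 : ℝ) 1)
    (hy : y ∈ Set.Icc (0 : ℝ) 1) : dombi l x y ≤ x := by
  rcases hx.1.eq_or_lt with rfl | hx0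
  · rw [dombi_zero_left]
  rcases hy.1.eq_or_lt with rfl | hy0
  · rw [dombi_zero_right]; exact hx.1
  have hp := one_sub_div_nonneg ⟨hx0, hx.2⟩
  have hq := one_sub_div_nonneg ⟨hy0, hy.2⟩
  rw [dombi, if_neg (by rintro (h | h); exacts [hx0.ne' h, hy0.ne' h]), ← not_lt,
    lt_one_add_inv_iff (by positivity) hx0, not_lt, one_div,
    Real.le_rpow_inv_iff_of_pos hp (by positivity) hl]
  linarith [Real.rpow_nonneg hq l]

/-- `V l b a` is the threshold in `x` at which `dombi l a x` reaches `b`. -/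
theorem dombi_lt_iff_lt_V {l a b x : ℝ} (hl : 0 < l) (hb : 0 < b) (hba : b ≤ a) (ha : a ≤ 1)
    (hx : x ∈ Set.Icc (0 : ℝ) 1) : dombi l a x < b ↔ x < V l b a := by
  have ha0 : 0 < a := hb.trans_le hba
  have hp := one_sub_div_nonneg ⟨ha0, ha⟩
  have hr := one_sub_div_nonneg ⟨hb, hba.trans ha⟩
  have hd : 0 ≤ ((1 - b) / b) ^ l - ((1 - a) / a) ^ l :=
    sub_nonneg.2 (Real.rpow_le_rpow hp (one_sub_div_le_one_sub_div hb hba) hl.le)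
  rcases hx.1.eq_or_lt with rfl | hx0
  · rw [dombi_zero_right, V]
    exact iff_of_true hb (by positivity)
  have hq := one_sub_div_nonneg ⟨hx0, hx.2⟩
  rw [dombi, V, if_neg (by rintro (h | h); exacts [ha0.ne' h, hx0.ne' h]),
    one_add_inv_lt_iff (by positivity) hb, lt_one_add_inv_iff (by positivity) hx0, one_div,
    Real.lt_rpow_inv_iff_of_pos hr (by positivity) hl,
    Real.rpow_inv_lt_iff_of_pos hd hq hl, sub_lt_iff_lt_add']

theorem dombi_le_iff_le_V {l a b x : ℝ} (hl : 0 < l) (hb : 0 < b) (hba : b ≤ a)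
    (ha : a ≤ 1) (hx : x ∈ Set.Icc (0 : ℝ) 1) : dombi l a x ≤ b ↔ x ≤ V l b a := by
  have ha0 : 0 < a := hb.trans_le hba
  have hp := one_sub_div_nonneg ⟨ha0, ha⟩
  have hr := one_sub_div_nonneg ⟨hb, hba.trans ha⟩
  have hd : 0 ≤ ((1 - b) / b) ^ l - ((1 - a) / a) ^ l :=
    sub_nonneg.2 (Real.rpow_le_rpow hp (one_sub_div_le_one_sub_div hb hba) hl.le)
  rcases hx.1.eq_or_lt with rfl | hx0
  · rw [dombi_zero_right, V]
    exact iff_of_true hb.le (by positivity)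
  have hq := one_sub_div_nonneg ⟨hx0, hx.2⟩
  rw [dombi, V, if_neg (by rintro (h | h); exacts [ha0.ne' h, hx0.ne' h]), ← not_lt,
    lt_one_add_inv_iff (by positivity) hb, not_lt, ← not_lt (b := x),
    one_add_inv_lt_iff (by positivity) hx0, not_lt, one_div,
    Real.le_rpow_inv_iff_of_pos hr (by positivity) hl,
    Real.rpow_inv_le_iff_of_pos hd hq hl, sub_le_iff_le_add']

theorem mem_feasible_iff {l : ℝ} {m n : ℕ} {A : Fin (m + 1) → Fin (n + 1) → ℝ}
    {b : Fin (m + 1) → ℝ} {x : Fin (n + 1) → ℝ} :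
    x ∈ feasible l A b ↔ (∀ j, x j ∈ Set.Icc (0 : ℝ) 1) ∧
      ∀ i, (∀ j, dombi l (A i j) (x j) ≤ b i) ∧ ∃ j, dombi l (A i j) (x j) = b i := by
  refine and_congr_right fun _ => forall_congr' fun i => ⟨fun h => ⟨fun j => ?_, ?_⟩, ?_⟩
  · rw [← h]
    exact Finset.le_sup' (fun j => dombi l (A i j) (x j)) (Finset.mem_univ j)
  · obtain ⟨j, -, hj⟩ := Finset.exists_mem_eq_sup' Finset.univ_nonempty
      (fun j => dombi l (A i j) (x j))
    exact ⟨j, hj ▸ h⟩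
  · rintro ⟨h, j, hj⟩
    refine le_antisymm (Finset.sup'_le _ _ fun j _ => h j) ?_
    rw [← hj]
    exact Finset.le_sup' (fun j => dombi l (A i j) (x j)) (Finset.mem_univ j)

section

variable {l : ℝ} {m n : ℕ} {A : Fin (m + 1) → Fin (n + 1) → ℝ} {b : Fin (m + 1) → ℝ}
  {x : Fin (n + 1) → ℝ}

theorem Abar_eq_zero_or_eq (l : ℝ) (A : Fin (m + 1) → Fin (n + 1) → ℝ) (b : Fin (m + 1) → ℝ)
    (i : Fin (m + 1)) (j : Fin (n + 1)) : Abar l A b i j = 0 ∨ Abar l A b i j = A i j := by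
  unfold Abar
  split_ifs <;> simp

theorem dombi_Abar_le (hA : ∀ i j, A i j ∈ Set.Icc (0 : ℝ) 1)
    (hx : ∀ j, x j ∈ Set.Icc (0 : ℝ) 1) (i : Fin (m + 1)) (j : Fin (n + 1)) :
    dombi l (Abar l A b i j) (x j) ≤ dombi l (A i j) (x j) := by
  rcases Abar_eq_zero_or_eq l A b i j with h | h
  · rw [h, dombi_zero_left]
    exact dombi_nonneg (hA i j) (hx j)
  · rw [h]

theorem eq_zero_of_dombi_nonpos {a y : ℝ} (ha : a ∈ Set.Ioc (0 : ℝ) 1)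
    (hy : y ∈ Set.Icc (0 : ℝ) 1) (h : dombi l a y ≤ 0) : y = 0 := by
  by_contra hy0
  exact h.not_gt (dombi_pos ha ⟨lt_of_le_of_ne hy.1 (Ne.symm hy0), hy.2⟩)

/-- An entry attaining its right-hand side is not reset. -/
theorem Abar_eq_of_dombi_eq (hl : 0 < l) (hA : ∀ i j, A i j ∈ Set.Icc (0 : ℝ) 1)
    (hx : ∀ j, x j ∈ Set.Icc (0 : ℝ) 1) (h : ∀ i j, dombi l (A i j) (x j) ≤ b i)
    {i : Fin (m + 1)} {j : Fin (n + 1)} (hij : dombi l (A i j) (x j) = b i) :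
    Abar l A b i j = A i j := by
  unfold Abar
  split_ifs with h₁ h₂ h₃
  · exact absurd (dombi_le_left hl (hA i j) (hx j)) (by rw [hij]; exact h₁.not_ge)
  · obtain ⟨hbi, i', -, hb', hle, hV⟩ := h₂
    have hx' := (dombi_le_iff_le_V hl hb' hle (hA i' j).2 (hx j)).1 (h i' j)
    exact absurd hij
      ((dombi_lt_iff_lt_V hl hbi (not_lt.1 h₁) (hA i j).2 (hx j)).2 (hx'.trans_lt hV)).ne
  · obtain ⟨hbi, i', -, hb', hpos⟩ := h₃
    have hx0 := eq_zero_of_dombi_nonpos ⟨hpos, (hA i' j).2⟩ (hx j) (hb' ▸ h i' j)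
    rw [hx0, dombi_zero_right] at hij
    exact absurd hij hbi.ne
  · rfl

theorem dombi_le_of_dombi_Abar_le (hl : 0 < l) (hA : ∀ i j, A i j ∈ Set.Icc (0 : ℝ) 1)
    (hb : ∀ i, 0 ≤ b i) (hx : ∀ j, x j ∈ Set.Icc (0 : ℝ) 1)
    (h : ∀ i j, dombi l (Abar l A b i j) (x j) ≤ b i) (i : Fin (m + 1)) (j : Fin (n + 1)) :
    dombi l (A i j) (x j) ≤ b i := by
  by_cases hz : ∃ k, b k = 0 ∧ 0 < A k j
  · obtain ⟨k, hbk, hk⟩ := hz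
    have hAk : Abar l A b k j = A k j := by simp [Abar, hbk, hk.not_gt]
    have hx0 := eq_zero_of_dombi_nonpos ⟨hk, (hA k j).2⟩ (hx j) (hAk ▸ hbk ▸ h k j)
    rw [hx0, dombi_zero_right]
    exact hb i
  rcases lt_or_ge (A i j) (b i) with hlt | hge
  · exact (dombi_le_left hl (hA i j) (hx j)).trans hlt.le
  rcases (hb i).eq_or_lt with hbi | hbi
  · have hAij : A i j = 0 :=
      le_antisymm (not_lt.1 fun hpos => hz ⟨i, hbi.symm, hpos⟩) (hA i j).1
    rw [hAij, dombi_zero_left]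
    exact hb i
  obtain ⟨k, hk, hmin⟩ := Finset.exists_min_image
    (Finset.univ.filter fun k => 0 < b k ∧ b k ≤ A k j) (fun k => V l (b k) (A k j))
    ⟨i, by simp [hbi, hge]⟩
  simp only [Finset.mem_filter, Finset.mem_univ, true_and] at hk hmin
  have hAk : Abar l A b k j = A k j := by
    rw [Abar, if_neg hk.2.not_gt, if_neg, if_neg]
    · rintro ⟨-, k', -, hk'⟩
      exact hz ⟨k', hk'⟩
    · rintro ⟨-, k', -, hb', hle, hV⟩
      exact (hmin k' ⟨hb', hle⟩).not_gt hV
  have hxk := (dombi_le_iff_le_V hl hk.1 hk.2 (hA k j).2 (hx j)).1 (hAk ▸ h k j)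
  exact (dombi_le_iff_le_V hl hbi hge (hA i j).2 (hx j)).2 (hxk.trans (hmin i ⟨hbi, hge⟩))

end

/-- (Theorem 1) The max-Dombi systems defined by `A` and by the reduced matrix `Ā`
have exactly the same solution sets. -/
theorem feasible_eq_feasible_Abar (l : ℝ) (hl : 0 < l) {m n : ℕ}
    (A : Fin (m + 1) → Fin (n + 1) → ℝ) (b : Fin (m + 1) → ℝ)
    (hA : ∀ i j, A i j ∈ Set.Icc (0 : ℝ) 1) (hb : ∀ i, b i ∈ Set.Icc (0 : ℝ) 1) :
    feasible l A b = feasible l (Abar l A b) b := by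
  ext x
  simp only [mem_feasible_iff]
  refine and_congr_right fun hx => ⟨fun h i => ?_, fun h i => ?_⟩
  · obtain ⟨hle, j, hj⟩ := h i
    refine ⟨fun j => (dombi_Abar_le hA hx i j).trans (hle j), j, ?_⟩
    rw [Abar_eq_of_dombi_eq hl hA hx (fun i => (h i).1) hj, hj]
  · have hle := dombi_le_of_dombi_Abar_le hl hA (fun i => (hb i).1) hx fun i => (h i).1
    obtain ⟨-, j, hj⟩ := h i
    exact ⟨hle i, j, le_antisymm (hle i j) (hj ▸ dombi_Abar_le hA hx i j)⟩
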